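/- Let F ∈ ℂ(z) be a nonzero rational function, let k₀ be the order of F at z = 0 (so F(z) ~ a₀ z^{k₀} as z → 0 with a₀ ≠ 0) and k_∞ the order at infinity (F(z) ~ a_∞ z^{k_∞} as z → ∞ with a_∞ ≠ 0). Assume k₀·k_∞ ≠ 0, and assume that every Darboux point of F (every z ≠ 0 with F′(z) = 0 and F(z) ≠ 0) is a simple root of F′ (equivalently F″(z) ≠ 0 there). Then the sum over all Darboux points z of F of the quantities F(z)/(z²·F″(z)) equals 1/k_∞ − 1/k₀. Equivalently, writing λ(z) = k − z²F″(z)/F(z) for any integer k, the sum of 1/(λ(z) − k) over all Darboux points z equals 1/k₀ − 1/k_∞. -/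

import Mathlib

open Filter

/-- The value of the rational function `F = A/B` at `z ∈ ℂ`. -/
noncomputable def Ffun (A B : Polynomial ℂ) (z : ℂ) : ℂ :=
  A.eval z / B.eval z

open Polynomial in
/-- The Wronskian-type numerator of `(A/B)′`. -/
noncomputable def wrk (A B : Polynomial ℂ) : Polynomial ℂ :=
  derivative A * B - A * derivative B

section helpers
open Polynomial Topology

lemma exponent_zero (f : ℂ → ℂ) (c d : ℂ) (hc : c ≠ 0) (hd : d ≠ 0) (n : ℤ)
    (h1 : Tendsto f (𝓝[≠] 0) (𝓝 c))
    (h2 : Tendsto (fun z => f z * z ^ n) (𝓝[≠] 0) (𝓝 d)) : n = 0 := by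
  have key : Tendsto (fun z : ℂ => z ^ n) (𝓝[≠] 0) (𝓝 (d / c)) := by
    refine (h2.div h1 hc).congr' ?_
    filter_upwards [h1.eventually_ne hc] with z hz
    simp only [Pi.div_apply]
    field_simp
  have pos : ∀ (m : ℤ) (e : ℂ), 0 < m → e ≠ 0 →
      ¬ Tendsto (fun z : ℂ => z ^ m) (𝓝[≠] 0) (𝓝 e) := by
    intro m e hm he h
    obtain ⟨k, rfl⟩ := Int.eq_ofNat_of_zero_le hm.le
    have h0 : Tendsto (fun z : ℂ => z ^ (k : ℤ)) (𝓝[≠] 0) (𝓝 0) := by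
      have : Continuous (fun z : ℂ => z ^ k) := by fun_prop
      have h := (this.tendsto 0).mono_left (nhdsWithin_le_nhds (s := {0}ᶜ))
      rw [zero_pow (by omega)] at h
      simpa using h
    exact he (tendsto_nhds_unique h h0)
  rcases lt_trichotomy n 0 with h | h | h
  · exfalso
    refine pos (-n) (d / c)⁻¹ (by omega) (inv_ne_zero (div_ne_zero hd hc)) ?_
    simpa [zpow_neg] using key.inv₀ (div_ne_zero hd hc)
  · exact h
  · exact absurd key (pos n _ h (div_ne_zero hd hc))

lemma local_form (A B : ℂ[X]) (hA : A ≠ 0) (hB : B ≠ 0) (r : ℂ) :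
    ∃ A1 B1 : ℂ[X], ∃ a b : ℕ, A = (X - C r) ^ a * A1 ∧ B = (X - C r) ^ b * B1 ∧
      A1.eval r ≠ 0 ∧ B1.eval r ≠ 0 ∧
      (X - C r) * wrk A B = (X - C r) ^ (a + b) *
        (C ((a : ℂ) - b) * (A1 * B1) + (X - C r) * wrk A1 B1) := by
  obtain ⟨A1, h1, h1'⟩ := exists_eq_pow_rootMultiplicity_mul_and_not_dvd A hA r
  obtain ⟨B1, h2, h2'⟩ := exists_eq_pow_rootMultiplicity_mul_and_not_dvd B hB r
  refine ⟨A1, B1, _, _, h1, h2, fun h => h1' (dvd_iff_isRoot.2 h),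
    fun h => h2' (dvd_iff_isRoot.2 h), ?_⟩
  generalize A.rootMultiplicity r = a at h1
  generalize B.rootMultiplicity r = b at h2
  have hd : ∀ (n : ℕ) (Q : ℂ[X]), (X - C r) * derivative ((X - C r) ^ n * Q) =
      (X - C r) ^ n * (C (n : ℂ) * Q + (X - C r) * derivative Q) := by
    intro n Q
    rcases n with _ | n
    · simp
    · rw [derivative_mul, derivative_X_sub_C_pow]
      simp only [Nat.add_sub_cancel, map_natCast]
      ring
  have ha := hd a A1
  have hb := hd b B1
  rw [← h1] at ha
  rw [← h2] at hb
  unfold wrk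
  have : (X - C r) * (derivative A * B - A * derivative B) =
    ((X - C r) * derivative A) * B - A * ((X - C r) * derivative B) := by ring
  rw [this, ha, hb]
  nth_rewrite 1 [h2]
  nth_rewrite 1 [h1]
  rw [C_sub]
  ring

lemma exponent_at_zero (A B A1 B1 : ℂ[X]) (a b : ℕ) (k : ℤ)
    (hA : A = X ^ a * A1) (hB : B = X ^ b * B1) (h1 : A1.eval 0 ≠ 0) (h2 : B1.eval 0 ≠ 0)
    (h0 : ∃ a₀ : ℂ, a₀ ≠ 0 ∧
      Tendsto (fun z : ℂ => Ffun A B z * z ^ (-k)) (nhdsWithin 0 {0}ᶜ) (nhds a₀)) :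
    k = (a : ℤ) - b := by
  obtain ⟨c, hc, h⟩ := h0
  have hT : Tendsto (fun z : ℂ => A1.eval z / B1.eval z) (𝓝[≠] 0) (𝓝 (A1.eval 0 / B1.eval 0)) :=
    ((A1.continuous.tendsto 0).div (B1.continuous.tendsto 0) h2).mono_left nhdsWithin_le_nhds
  have := exponent_zero _ _ c (div_ne_zero h1 h2) hc ((a : ℤ) - b - k) hT (h.congr' ?_)
  · omega
  · filter_upwards [self_mem_nhdsWithin] with z hz
    have hz : z ≠ 0 := hz
    simp only [Ffun, hA, hB, eval_mul, eval_pow, eval_X]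
    rw [zpow_sub₀ hz, zpow_sub₀ hz, zpow_neg, zpow_natCast, zpow_natCast]
    field_simp

lemma exponent_at_inf (A B : ℂ[X]) (hA : A ≠ 0) (hB : B ≠ 0) (k : ℤ)
    (hinf : ∃ ainf : ℂ, ainf ≠ 0 ∧
      Tendsto (fun z : ℂ => Ffun A B z * z ^ (-k)) (Bornology.cobounded ℂ) (nhds ainf)) :
    k = (A.natDegree : ℤ) - B.natDegree := by
  obtain ⟨c, hc, h⟩ := hinf
  have h' := h.comp (tendsto_inv₀_nhdsNE_zero (α := ℂ))
  have e : ∀ P : ℂ[X], P ≠ 0 → P.reverse.eval 0 ≠ 0 := by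
    intro P hP
    rw [← coeff_zero_eq_eval_zero, coeff_zero_reverse]
    exact leadingCoeff_ne_zero.2 hP
  have ev : ∀ (P : ℂ[X]) (z : ℂ), z ≠ 0 → P.eval z⁻¹ = P.reverse.eval z * (z ^ P.natDegree)⁻¹ := by
    intro P z hz
    haveI : Invertible (z⁻¹) := invertibleOfNonzero (inv_ne_zero hz)
    have := eval₂_reverse_mul_pow (RingHom.id ℂ) (z⁻¹) P
    rw [invOf_eq_inv, inv_inv, inv_pow] at this
    exact this.symm
  have hT : Tendsto (fun z : ℂ => A.reverse.eval z / B.reverse.eval z) (𝓝[≠] 0)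
      (𝓝 (A.reverse.eval 0 / B.reverse.eval 0)) :=
    ((A.reverse.continuous.tendsto 0).div (B.reverse.continuous.tendsto 0)
      (e B hB)).mono_left nhdsWithin_le_nhds
  have := exponent_zero _ _ c (div_ne_zero (e A hA) (e B hB)) hc
    (k - ((A.natDegree : ℤ) - B.natDegree)) hT (h'.congr' ?_)
  · omega
  · filter_upwards [self_mem_nhdsWithin] with z hz
    have hz : z ≠ 0 := hz
    simp only [Ffun, Function.comp, ev _ z hz]
    rw [zpow_sub₀ hz, zpow_sub₀ hz, inv_zpow, zpow_neg, inv_inv, zpow_natCast, zpow_natCast]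
    field_simp

lemma wrk_deg (A B : ℂ[X]) (hA : A ≠ 0) (hB : B ≠ 0)
    (h : (A.natDegree : ℂ) - B.natDegree ≠ 0) :
    (X * wrk A B).natDegree = A.natDegree + B.natDegree ∧
    (X * wrk A B).leadingCoeff =
      ((A.natDegree : ℂ) - B.natDegree) * (A.leadingCoeff * B.leadingCoeff) := by
  have hX : ∀ P : ℂ[X], (X * derivative P).natDegree ≤ P.natDegree := by
    intro P
    rw [natDegree_le_iff_coeff_eq_zero]
    intro N hN
    rcases N with _ | N
    · simp
    · rw [coeff_X_mul, coeff_derivative, coeff_eq_zero_of_natDegree_lt hN, zero_mul]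
  have hc : ∀ P : ℂ[X], (X * derivative P).coeff P.natDegree = P.natDegree * P.leadingCoeff := by
    intro P
    rcases hn : P.natDegree with _ | N
    · simp
    · rw [coeff_X_mul, coeff_derivative, leadingCoeff, hn]; push_cast; ring
  have he : X * wrk A B = (X * derivative A) * B - A * (X * derivative B) := by
    unfold wrk; ring
  have hle : (X * wrk A B).natDegree ≤ A.natDegree + B.natDegree := by
    rw [he]
    refine (natDegree_sub_le _ _).trans (max_le ?_ ?_)
    · exact natDegree_mul_le.trans (Nat.add_le_add_right (hX A) _)
    · exact natDegree_mul_le.trans (Nat.add_le_add_left (hX B) _)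
  have hco : (X * wrk A B).coeff (A.natDegree + B.natDegree) =
      ((A.natDegree : ℂ) - B.natDegree) * (A.leadingCoeff * B.leadingCoeff) := by
    rw [he, coeff_sub, coeff_mul_add_eq_of_natDegree_le (hX A) le_rfl,
      coeff_mul_add_eq_of_natDegree_le le_rfl (hX B), hc, hc]
    simp only [coeff_natDegree]
    ring
  have hne : (X * wrk A B).coeff (A.natDegree + B.natDegree) ≠ 0 := by
    rw [hco]
    exact mul_ne_zero h (mul_ne_zero (leadingCoeff_ne_zero.2 hA) (leadingCoeff_ne_zero.2 hB))
  have hd : (X * wrk A B).natDegree = A.natDegree + B.natDegree :=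
    le_antisymm hle (le_natDegree_of_ne_zero hne)
  exact ⟨hd, by rw [leadingCoeff, hd, hco]⟩

lemma deriv_Ffun (A B : ℂ[X]) (z : ℂ) (hz : B.eval z ≠ 0) :
    deriv (Ffun A B) z = (wrk A B).eval z / (B.eval z) ^ 2 := by
  have := ((A.hasDerivAt z).div (B.hasDerivAt z) hz).deriv
  have e : Ffun A B = (fun x => A.eval x) / (fun x => B.eval x) := rfl
  rw [e, this]
  simp [wrk]

lemma deriv2_Ffun (A B : ℂ[X]) (z : ℂ) (hz : B.eval z ≠ 0) (hw : (wrk A B).eval z = 0) :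
    deriv (deriv (Ffun A B)) z = (derivative (wrk A B)).eval z / (B.eval z) ^ 2 := by
  have e : deriv (Ffun A B) =ᶠ[𝓝 z] Ffun (wrk A B) (B ^ 2) := by
    filter_upwards [B.continuous.continuousAt.eventually_ne hz] with x hx
    rw [deriv_Ffun A B x hx, Ffun, eval_pow]
  have h2 : (B ^ 2).eval z ≠ 0 := by rw [eval_pow]; exact pow_ne_zero _ hz
  rw [e.deriv_eq, deriv_Ffun _ _ z h2]
  conv_lhs => rw [wrk]
  simp only [eval_sub, eval_mul, eval_pow, hw, zero_mul, sub_zero]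
  field_simp

end helpers

/-- Let `F = A/B ∈ ℂ(z)` be a nonzero rational function in lowest terms, with asymptotic
exponents `k₀ ≠ 0` at `0` and `kinf ≠ 0` at `∞`, and suppose every Darboux point of `F`
(`z ≠ 0`, `F′(z) = 0`, `F(z) ≠ 0`) is simple (`F″(z) ≠ 0`). If `D` is the (finite) set of
Darboux points of `F`, then `∑_{z ∈ D} F(z)/(z²F″(z)) = 1/kinf − 1/k₀`. -/
theorem sum_residues_at_darboux_points
    (A B : Polynomial ℂ) (hA : A ≠ 0) (hB : B ≠ 0) (hcop : IsCoprime A B)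
    (k₀ kinf : ℤ) (hk₀ : k₀ ≠ 0) (hkinf : kinf ≠ 0)
    (h0 : ∃ a₀ : ℂ, a₀ ≠ 0 ∧
      Tendsto (fun z : ℂ => Ffun A B z * z ^ (-k₀)) (nhdsWithin 0 {0}ᶜ) (nhds a₀))
    (hinf : ∃ ainf : ℂ, ainf ≠ 0 ∧
      Tendsto (fun z : ℂ => Ffun A B z * z ^ (-kinf)) (Bornology.cobounded ℂ) (nhds ainf))
    (hsimple : ∀ z : ℂ, z ≠ 0 → B.eval z ≠ 0 → deriv (Ffun A B) z = 0 →
      Ffun A B z ≠ 0 → deriv (deriv (Ffun A B)) z ≠ 0)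
    (D : Finset ℂ)
    (hD : ∀ z : ℂ, z ∈ D ↔
      (z ≠ 0 ∧ B.eval z ≠ 0 ∧ deriv (Ffun A B) z = 0 ∧ Ffun A B z ≠ 0)) :
    ∑ z ∈ D, Ffun A B z / (z ^ 2 * deriv (deriv (Ffun A B)) z)
      = (kinf : ℂ)⁻¹ - (k₀ : ℂ)⁻¹ := by
  classical
  have hki := exponent_at_inf A B hA hB kinf hinf
  have hkiC : (kinf : ℂ) = (A.natDegree : ℂ) - B.natDegree := by rw [hki]; push_cast; ring
  have hkiC0 : (A.natDegree : ℂ) - B.natDegree ≠ 0 := by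
    rw [← hkiC]; exact_mod_cast hkinf
  obtain ⟨hdeg, hlc⟩ := wrk_deg A B hA hB hkiC0
  have hlA := Polynomial.leadingCoeff_ne_zero.2 hA
  have hlB := Polynomial.leadingCoeff_ne_zero.2 hB
  have hXW : Polynomial.X * wrk A B ≠ 0 := by
    rw [← Polynomial.leadingCoeff_ne_zero, hlc]
    exact mul_ne_zero hkiC0 (mul_ne_zero hlA hlB)
  have hW : wrk A B ≠ 0 := right_ne_zero_of_mul hXW
  have h0D : (0 : ℂ) ∉ D := fun h => ((hD 0).1 h).1 rfl
  have hroot : ∀ z, A.eval z ≠ 0 → B.eval z ≠ 0 → z ≠ 0 → ((wrk A B).eval z = 0 ↔ z ∈ D) := by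
    intro z h1 h2 h3
    rw [hD, deriv_Ffun A B z h2]
    simp [Ffun, h1, h2, h3]
  have hDp : ∀ z ∈ D, z ≠ 0 ∧ A.eval z ≠ 0 ∧ B.eval z ≠ 0 ∧ (wrk A B).eval z = 0 ∧
      (Polynomial.derivative (wrk A B)).eval z ≠ 0 := by
    intro z hz
    obtain ⟨h1, h2, h3, h4⟩ := (hD z).1 hz
    have hAz : A.eval z ≠ 0 := fun h => h4 (by simp [Ffun, h])
    have hw := (hroot z hAz h2 h1).2 hz
    refine ⟨h1, hAz, h2, hw, fun h => hsimple z h1 h2 h3 h4 ?_⟩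
    rw [deriv2_Ffun A B z h2 hw, h, zero_div]
  set M : Polynomial ℂ := Lagrange.nodal (insert 0 D) id with hM
  have hM1 : M = Polynomial.X * Lagrange.nodal D id := by
    rw [hM, Lagrange.nodal_insert_eq_nodal h0D]; simp
  have hM0 : M ≠ 0 := Lagrange.nodal_ne_zero
  have hMr : ∀ z ∈ insert 0 D, M.eval z = 0 := fun z hz =>
    Lagrange.eval_nodal_at_node (v := id) hz
  obtain ⟨A0, B0, a0, b0, hA0, hB0, hA0r, hB0r, hW0⟩ := local_form A B hA hB 0
  simp only [map_zero, sub_zero] at hA0 hB0 hW0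
  have hk := exponent_at_zero A B A0 B0 a0 b0 k₀ hA0 hB0 hA0r hB0r h0
  have hkC : (k₀ : ℂ) = (a0 : ℂ) - b0 := by rw [hk]; push_cast; ring
  have hABM : A * B * M ≠ 0 := mul_ne_zero (mul_ne_zero hA hB) hM0
  have hXXW : Polynomial.X * (Polynomial.X * wrk A B) ≠ 0 := mul_ne_zero Polynomial.X_ne_zero hXW
  have hdvd : Polynomial.X * (Polynomial.X * wrk A B) ∣ A * B * M := by
    rw [IsAlgClosed.dvd_iff_roots_le_roots hXXW hABM, Multiset.le_iff_count]
    intro r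
    rw [Polynomial.count_roots, Polynomial.count_roots, Polynomial.rootMultiplicity_mul hXXW,
      Polynomial.rootMultiplicity_mul hABM]
    have hXr : r ≠ 0 → Polynomial.rootMultiplicity r (Polynomial.X : Polynomial ℂ) = 0 := by
      intro hr
      exact Polynomial.rootMultiplicity_eq_zero (by simpa using hr)
    have hMp : r ∈ insert 0 D → 1 ≤ Polynomial.rootMultiplicity r M := by
      intro hr
      exact (Polynomial.rootMultiplicity_pos hM0).2 (hMr r hr)
    by_cases hAB : A.eval r ≠ 0 ∧ B.eval r ≠ 0
    · have hr0 : r ≠ 0 := by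
        rintro rfl
        apply hk₀
        have ha : a0 = 0 := by
          by_contra h
          exact hAB.1 (by rw [hA0]; simp [h])
        have hb : b0 = 0 := by
          by_contra h
          exact hAB.2 (by rw [hB0]; simp [h])
        rw [hk, ha, hb]; simp
      rw [Polynomial.rootMultiplicity_mul hXW, hXr hr0]
      by_cases hrD : r ∈ D
      · have h1 : Polynomial.rootMultiplicity r (wrk A B) ≤ 1 := by
          by_contra h
          have := (Polynomial.one_lt_rootMultiplicity_iff_isRoot hW).1 (not_le.1 h)
          exact (hDp r hrD).2.2.2.2 this.2
        have := hMp (Finset.mem_insert_of_mem hrD)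
        omega
      · have : Polynomial.rootMultiplicity r (wrk A B) = 0 :=
          Polynomial.rootMultiplicity_eq_zero
            (fun h => hrD ((hroot r hAB.1 hAB.2 hr0).1 h))
        omega
    · obtain ⟨A1, B1, a, b, hA1, hB1, hA1r, hB1r, hW1⟩ := local_form A B hA hB r
      have hab : (a : ℂ) - b ≠ 0 := by
        intro h
        have hab : a = b := by exact_mod_cast sub_eq_zero.1 h
        subst hab
        rcases Nat.eq_zero_or_pos a with ha | ha
        · subst ha
          apply hAB
          rw [hA1, hB1]
          simpa using ⟨hA1r, hB1r⟩
        · obtain ⟨u, v, huv⟩ := hcop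
          have := congrArg (Polynomial.eval r) huv
          rw [hA1, hB1] at this
          simp [ha.ne'] at this
      set V := Polynomial.C ((a : ℂ) - b) * (A1 * B1) +
        (Polynomial.X - Polynomial.C r) * wrk A1 B1 with hV
      have hVr : V.eval r ≠ 0 := by
        have : V.eval r = ((a : ℂ) - b) * (A1.eval r * B1.eval r) := by simp [hV]
        rw [this]
        exact mul_ne_zero hab (mul_ne_zero hA1r hB1r)
      have rm : ∀ (n : ℕ) (Q : Polynomial ℂ), Q.eval r ≠ 0 →
          Polynomial.rootMultiplicity r ((Polynomial.X - Polynomial.C r) ^ n * Q) = n := by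
        intro n Q hQ
        have hQ0 : Q ≠ 0 := by rintro rfl; simp at hQ
        rw [mul_comm, Polynomial.rootMultiplicity_mul_X_sub_C_pow hQ0,
          Polynomial.rootMultiplicity_eq_zero (fun h => hQ h), zero_add]
      have e1 : Polynomial.rootMultiplicity r (A * B) = a + b := by
        rw [← rm (a + b) (A1 * B1) (by simpa using ⟨hA1r, hB1r⟩)]
        congr 1
        rw [hA1, hB1, pow_add]; ring
      have hTne : (Polynomial.X - Polynomial.C r) * wrk A B ≠ 0 :=
        mul_ne_zero (Polynomial.X_sub_C_ne_zero r) hW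
      have e2 : 1 + Polynomial.rootMultiplicity r (wrk A B) = a + b := by
        rw [← rm (a + b) V hVr, ← hW1, Polynomial.rootMultiplicity_mul hTne,
          Polynomial.rootMultiplicity_X_sub_C_self]
      rw [Polynomial.rootMultiplicity_mul hXW, e1]
      by_cases hr0 : r = 0
      · have hx : Polynomial.rootMultiplicity r (Polynomial.X : Polynomial ℂ) = 1 := by
          have := Polynomial.rootMultiplicity_X_sub_C_self (x := r)
          rwa [hr0, map_zero, sub_zero, ← hr0] at this
        have := hMp (by simp [hr0])
        omega
      · rw [hXr hr0]
        omega
  obtain ⟨N, hN⟩ := hdvd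
  have hN0 : N ≠ 0 := by
    rintro rfl
    exact hABM (by rw [hN, mul_zero])
  have hMdeg : M.natDegree = D.card + 1 := by
    rw [hM, Lagrange.natDegree_nodal, Finset.card_insert_of_notMem h0D]
  have hNdeg : N.natDegree = D.card := by
    have := congrArg Polynomial.natDegree hN
    rw [Polynomial.natDegree_mul (mul_ne_zero hA hB) hM0, Polynomial.natDegree_mul hA hB,
      Polynomial.natDegree_mul hXXW hN0, Polynomial.natDegree_mul Polynomial.X_ne_zero hXW,
      hdeg, Polynomial.natDegree_X, hMdeg] at this
    omega
  have hNlc : N.leadingCoeff = (kinf : ℂ)⁻¹ := by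
    have := congrArg Polynomial.leadingCoeff hN
    have hMm : M.leadingCoeff = 1 := Lagrange.nodal_monic
    rw [Polynomial.leadingCoeff_mul, Polynomial.leadingCoeff_mul, Polynomial.leadingCoeff_mul,
      Polynomial.leadingCoeff_mul, hlc, Polynomial.leadingCoeff_X, hMm, ← hkiC] at this
    have hk' : (kinf : ℂ) ≠ 0 := by exact_mod_cast hkinf
    apply eq_inv_of_mul_eq_one_left
    apply mul_left_cancel₀ (mul_ne_zero hlA hlB)
    linear_combination -this
  have hsum := Lagrange.leadingCoeff_eq_sum (s := insert 0 D) (v := id) (P := N)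
    (Function.injective_id.injOn) (by
      rw [Polynomial.degree_eq_natDegree hN0, hNdeg, Finset.card_insert_of_notMem h0D]
      push_cast; rfl)
  have hprod : ∀ z ∈ insert 0 D, ∏ j ∈ (insert 0 D).erase z, (id z - id j) =
      (Polynomial.derivative M).eval z := by
    intro z hz
    have := Lagrange.eval_nodal_derivative_eval_node_eq (s := insert 0 D) (v := (id : ℂ → ℂ)) hz
    rw [Lagrange.eval_nodal] at this
    exact this.symm
  rw [Finset.sum_congr rfl (fun z hz => by rw [hprod z hz]), Finset.sum_insert h0D, hNlc] at hsum
  have hk0C : (k₀ : ℂ) ≠ 0 := by exact_mod_cast hk₀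
  have hzero : N.eval (id 0) / (Polynomial.derivative M).eval 0 = (k₀ : ℂ)⁻¹ := by
    have e : (Polynomial.C ((a0 : ℂ) - b0) * (A0 * B0) + Polynomial.X * wrk A0 B0) * N
        = A0 * B0 * Lagrange.nodal D id := by
      apply mul_left_cancel₀ (pow_ne_zero (a0 + b0 + 1) (Polynomial.X_ne_zero (R := ℂ)))
      have h := hN
      rw [hW0, hM1] at h
      nth_rewrite 1 [hA0] at h
      nth_rewrite 1 [hB0] at h
      linear_combination -h
    have e0 := congrArg (Polynomial.eval 0) e
    simp only [Polynomial.eval_mul, Polynomial.eval_add, Polynomial.eval_C, Polynomial.eval_X,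
      zero_mul, add_zero, ← hkC] at e0
    have hn : (Lagrange.nodal D id).eval (0 : ℂ) ≠ 0 := by
      rw [Lagrange.eval_nodal, Finset.prod_ne_zero_iff]
      intro z hz h
      exact (hDp z hz).1 (by simpa using h)
    have hd : (Polynomial.derivative M).eval 0 = (Lagrange.nodal D id).eval (0 : ℂ) := by
      rw [hM1]; simp
    rw [hd, id, div_eq_iff hn, eq_inv_mul_iff_mul_eq₀ hk0C]
    apply mul_left_cancel₀ (mul_ne_zero hA0r hB0r)
    linear_combination e0
  rw [hzero] at hsum
  rw [hsum, add_sub_cancel_left]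
  refine Finset.sum_congr rfl fun z hz => ?_
  obtain ⟨h1, h2, h3, h4, h5⟩ := hDp z hz
  rw [deriv2_Ffun A B z h3 h4, Ffun]
  have hm := hMr z (Finset.mem_insert_of_mem hz)
  have e := congrArg (fun P => (Polynomial.derivative P).eval z) hN
  simp only [Polynomial.derivative_mul, Polynomial.eval_add, Polynomial.eval_mul, hm, h4,
    Polynomial.eval_X, mul_zero, zero_mul, add_zero, zero_add, Polynomial.derivative_X,
    Polynomial.eval_one, one_mul] at e
  have hd : (Polynomial.derivative M).eval z ≠ 0 := by
    rw [← hprod z (Finset.mem_insert_of_mem hz), Finset.prod_ne_zero_iff]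
    intro j hj h
    exact (Finset.mem_erase.1 hj).1 (sub_eq_zero.1 h).symm
  simp only [id]
  field_simp
  linear_combination e
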